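/- arXiv:0908.2543 — 2 statements merged into one kernel-verified Lean document; each statement's English description precedes it below -/
import Mathlib

section
/- Let G be a finite simple graph with maximum degree Δ ≥ 1 and minimum degree δ satisfying e·Δ² ≤ 2^{δ−1} (where e is Euler's number). Then G has a double total dominating set, i.e., there exists T ⊊ V(G) such that every vertex of G has at least one neighbor in T and at least one neighbor in V(G)∖T. -/
open SimpleGraph Set

open Finset in
/-- The outcomes that avoid all the events `A i`, `i ∈ S`. -/
def avoiding {Ω ι : Type*} [Fintype Ω] [DecidableEq Ω] (A : ι → Finset Ω) (S : Finset ι) :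
    Finset Ω :=
  univ.filter fun ω => ∀ i ∈ S, ω ∉ A i

section LocalLemma

open Finset

variable {Ω ι : Type*} [Fintype Ω] [DecidableEq Ω] {A : ι → Finset Ω}

lemma mem_avoiding {S : Finset ι} {ω : Ω} : ω ∈ avoiding A S ↔ ∀ i ∈ S, ω ∉ A i := by
  simp [avoiding]

lemma avoiding_anti {S T : Finset ι} (h : S ⊆ T) : avoiding A T ⊆ avoiding A S := fun _ hω =>
  mem_avoiding.2 fun i hi => mem_avoiding.1 hω i (h hi)

lemma avoiding_insert [DecidableEq ι] (i : ι) (S : Finset ι) :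
    avoiding A (insert i S) = avoiding A S \ A i := by
  ext ω
  simp [mem_avoiding, and_comm]

/-- If each event has conditional density at most `x` given the avoidance of any set of events
strictly inside `S`, then avoiding `R ⊆ S \ T` on top of `T` costs at most a factor
`(1 - x) ^ #R`. -/
lemma pow_mul_card_avoiding_le [DecidableEq ι] {x : ℝ} (hx : x ≤ 1) {S : Finset ι}
    (hS : ∀ T ⊂ S, ∀ i, (#(A i ∩ avoiding A T) : ℝ) ≤ x * #(avoiding A T))
    (R T : Finset ι) (hRT : Disjoint R T) (hsub : R ∪ T ⊆ S) :
    (1 - x) ^ #R * #(avoiding A T) ≤ (#(avoiding A (R ∪ T)) : ℝ) := by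
  induction R using Finset.induction_on with
  | empty => simp
  | insert i R hi ih =>
    rw [Finset.disjoint_insert_left] at hRT
    rw [Finset.insert_union] at hsub ⊢
    have hiRT : i ∉ R ∪ T := by simp [hi, hRT.1]
    have ih' := ih hRT.2 ((Finset.subset_insert _ _).trans hsub)
    have hcond := hS (R ∪ T) ((Finset.ssubset_insert hiRT).trans_subset hsub) i
    have hcard := card_sdiff_add_card_inter (avoiding A (R ∪ T)) (A i)
    rw [Finset.inter_comm, ← avoiding_insert] at hcard
    have hcard' : (#(avoiding A (insert i (R ∪ T))) : ℝ) + #(A i ∩ avoiding A (R ∪ T))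
        = #(avoiding A (R ∪ T)) := by exact_mod_cast hcard
    rw [card_insert_of_notMem hi, pow_succ']
    nlinarith [mul_le_mul_of_nonneg_left ih' (sub_nonneg.2 hx)]

/-- The key estimate of the (lopsided, symmetric) local lemma. -/
lemma card_inter_avoiding_le [DecidableEq ι] {p x : ℝ} {d : ℕ} {Γ : ι → Finset ι}
    (hx0 : 0 ≤ x) (hx1 : x ≤ 1) (hp : p ≤ x * (1 - x) ^ d) (hΓ : ∀ i, #(Γ i) ≤ d)
    (hA : ∀ i S, i ∉ S → Disjoint S (Γ i) →
      (#(A i ∩ avoiding A S) : ℝ) ≤ p * #(avoiding A S))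
    (S : Finset ι) (i : ι) : (#(A i ∩ avoiding A S) : ℝ) ≤ x * #(avoiding A S) := by
  induction S using Finset.strongInduction generalizing i with
  | H S ih =>
    by_cases hi : i ∈ S
    · have : A i ∩ avoiding A S = ∅ := by
        ext ω
        simp only [Finset.mem_inter, Finset.notMem_empty, iff_false, not_and]
        exact fun h h' => mem_avoiding.1 h' i hi h
      rw [this, Finset.card_empty, Nat.cast_zero]
      positivity
    · have hun : S ∩ Γ i ∪ S \ Γ i = S := by
        rw [Finset.union_comm, Finset.sdiff_union_inter]
      have hlow := pow_mul_card_avoiding_le hx1 ih (S ∩ Γ i) (S \ Γ i)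
        (disjoint_sdiff_inter S (Γ i)).symm hun.subset
      rw [hun] at hlow
      have hpow : (1 - x) ^ d ≤ (1 - x) ^ #(S ∩ Γ i) :=
        pow_le_pow_of_le_one (sub_nonneg.2 hx1) (by linarith)
          ((Finset.card_le_card Finset.inter_subset_right).trans (hΓ i))
      calc (#(A i ∩ avoiding A S) : ℝ)
          ≤ #(A i ∩ avoiding A (S \ Γ i)) := by
            exact_mod_cast Finset.card_le_card
              (Finset.inter_subset_inter_left (avoiding_anti Finset.sdiff_subset))
        _ ≤ p * #(avoiding A (S \ Γ i)) :=
            hA i _ (fun h => hi (Finset.mem_sdiff.1 h).1) sdiff_disjoint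
        _ ≤ x * (1 - x) ^ #(S ∩ Γ i) * #(avoiding A (S \ Γ i)) := by
            gcongr
            exact hp.trans (by gcongr)
        _ ≤ x * #(avoiding A S) := by
            rw [mul_assoc]
            gcongr

lemma inv_exp_one_le_one_sub_pow {d : ℕ} (hd : 1 ≤ d) :
    (Real.exp 1)⁻¹ ≤ (1 - 1 / ((d : ℝ) + 1)) ^ d := by
  have hd0 : (0 : ℝ) < d := by exact_mod_cast hd
  have h1 : (1 - 1 / ((d : ℝ) + 1)) = (1 / (d : ℝ) + 1)⁻¹ := by
    field_simp
    ring
  rw [h1, inv_pow]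
  gcongr
  calc (1 / (d : ℝ) + 1) ^ d ≤ Real.exp (1 / d) ^ d := by
        gcongr
        exact Real.add_one_le_exp _
    _ = Real.exp 1 := by
        rw [← Real.exp_nat_mul, mul_one_div_cancel hd0.ne']

/-- The symmetric Lovász local lemma for the uniform distribution on a finite type, in lopsided
form: if each event `A i` has density at most `p` conditionally on avoiding any events outside
`{i} ∪ Γ i`, where `#(Γ i) ≤ d` and `e p (d + 1) ≤ 1`, then some outcome avoids all events. -/
theorem exists_forall_notMem_of_exp_mul_le [Nonempty Ω] [Fintype ι] [DecidableEq ι] {p : ℝ}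
    {d : ℕ} (hd : 1 ≤ d) {Γ : ι → Finset ι} (hΓ : ∀ i, #(Γ i) ≤ d)
    (hA : ∀ i S, i ∉ S → Disjoint S (Γ i) →
      (#(A i ∩ avoiding A S) : ℝ) ≤ p * #(avoiding A S))
    (hp : Real.exp 1 * p * (d + 1) ≤ 1) : ∃ ω, ∀ i, ω ∉ A i := by
  have hd0 : (0 : ℝ) < d := by exact_mod_cast hd
  set x : ℝ := 1 / ((d : ℝ) + 1) with hx
  have hx0 : 0 ≤ x := by positivity
  have hx1 : x < 1 := by
    rw [hx, div_lt_one (by positivity)]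
    linarith
  have hpx : p ≤ x * (1 - x) ^ d := by
    calc p ≤ x * (Real.exp 1)⁻¹ := by
          rw [hx, one_div, ← mul_inv, ← one_div, le_div_iff₀ (by positivity)]
          linarith
      _ ≤ x * (1 - x) ^ d := by
          gcongr
          exact inv_exp_one_le_one_sub_pow hd
  have hlow := pow_mul_card_avoiding_le hx1.le
    (fun T _ => card_inter_avoiding_le hx0 hx1.le hpx hΓ hA T)
    (univ : Finset ι) ∅ (disjoint_empty_right _) (Finset.subset_univ _)
  have hpos : (0 : ℝ) < (1 - x) ^ #(univ : Finset ι) * #(avoiding A ∅) := by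
    have : 0 < #(avoiding A ∅) := card_pos.2 ⟨Classical.arbitrary Ω, by simp [mem_avoiding]⟩
    have := sub_pos.2 hx1
    positivity
  obtain ⟨ω, hω⟩ := card_pos.1 (Nat.cast_pos.1 (hpos.trans_le hlow))
  exact ⟨ω, fun i => mem_avoiding.1 hω i (by simp)⟩

end LocalLemma

section Monochromatic

open Finset

variable {V : Type*} [Fintype V] [DecidableEq V]

/-- The sets `T` for which `N` is monochromatic: contained in `T` or disjoint from `T`. -/
def monochromatic (N : Finset V) : Finset (Finset V) :=
  univ.filter fun T => N ⊆ T ∨ Disjoint N T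

lemma mem_monochromatic {N T : Finset V} : T ∈ monochromatic N ↔ N ⊆ T ∨ Disjoint N T := by
  simp [monochromatic]

lemma mem_monochromatic_congr {N T T' : Finset V} (h : ∀ a ∈ N, a ∈ T ↔ a ∈ T') :
    T ∈ monochromatic N ↔ T' ∈ monochromatic N := by
  simp only [mem_monochromatic, Finset.subset_iff, Finset.disjoint_left]
  grind

/-- If membership in `B` does not depend on the elements of the nonempty set `N`, then the sets
making `N` monochromatic have density at most `2 / 2 ^ #N` in `B`. -/
lemma two_pow_mul_card_monochromatic_inter_le {N : Finset V} (hN : N.Nonempty)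
    {B : Finset (Finset V)} (hB : ∀ T T', T \ N = T' \ N → T ∈ B → T' ∈ B) :
    2 ^ #N * #(monochromatic N ∩ B) ≤ 2 * #B := by
  obtain ⟨a, ha⟩ := hN
  rw [← card_powerset, ← Fintype.card_bool, ← Finset.card_univ, ← card_product, ← card_product]
  refine card_le_card_of_injOn (fun q => (decide (a ∈ q.2), q.2 \ N ∪ q.1)) ?_ ?_
  · rintro ⟨X, T⟩ hq
    simp only [coe_product, Set.mem_prod, mem_coe, Finset.mem_powerset, Finset.mem_inter] at hq
    simp only [coe_product, Set.mem_prod, mem_coe, Finset.mem_univ, true_and]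
    refine hB T _ ?_ hq.2.2
    ext b
    have := @hq.1 b
    simp only [Finset.mem_sdiff, Finset.mem_union]
    tauto
  · rintro ⟨X, T⟩ hq ⟨X', T'⟩ hq' heq
    simp only [coe_product, Set.mem_prod, mem_coe, Finset.mem_powerset, Finset.mem_inter,
      mem_monochromatic] at hq hq'
    simp only [Prod.mk.injEq, decide_eq_decide] at heq
    obtain ⟨hX, hT, -⟩ := hq
    obtain ⟨hX', hT', -⟩ := hq'
    obtain ⟨haT, hU⟩ := heq
    have hmem : ∀ b, b ∈ T \ N ∪ X ↔ b ∈ T' \ N ∪ X' := fun b => by rw [hU]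
    simp only [Finset.mem_union, Finset.mem_sdiff] at hmem
    simp only [Finset.subset_iff, Finset.disjoint_left] at hX hX' hT hT'
    have hXX : X = X' := by
      ext b
      grind
    have hTT : T = T' := by
      ext b
      grind
    rw [hXX, hTT]

end Monochromatic

/-- If `G` is a finite graph with maximum degree `Δ ≥ 1` and minimum degree `δ` satisfying
`e·Δ² ≤ 2^(δ-1)`, then `G` has a double total dominating set `T ⊊ V(G)`: every vertex has a
neighbor in `T` and a neighbor outside `T`. -/
theorem exists_double_total_dominating_set {V : Type*} [Fintype V] (G : SimpleGraph V)
    [DecidableRel G.Adj] (hΔ : 1 ≤ G.maxDegree)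
    (h : Real.exp 1 * (G.maxDegree : ℝ) ^ 2 ≤ (2 : ℝ) ^ ((G.minDegree : ℝ) - 1)) :
    ∃ T : Set V, T ⊂ Set.univ ∧
      ∀ v : V, (∃ u ∈ T, G.Adj v u) ∧ (∃ u ∉ T, G.Adj v u) := by
  classical
  have hV : Nonempty V := by
    by_contra hV
    rw [not_nonempty_iff] at hV
    have := G.maxDegree_le_of_forall_degree_le 0 (fun v => (hV.false v).elim)
    omega
  have he : (2 : ℝ) < Real.exp 1 := by linarith [Real.exp_one_gt_d9]
  rw [Real.rpow_sub_one two_ne_zero, Real.rpow_natCast] at h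
  have hδ : 2 ≤ G.minDegree := by
    by_contra! hlt
    have h1 : (1 : ℝ) ≤ (G.maxDegree : ℝ) ^ 2 := one_le_pow₀ (by exact_mod_cast hΔ)
    have h2 : (2 : ℝ) ^ G.minDegree ≤ 2 ^ 1 := pow_le_pow_right₀ one_le_two (by omega)
    nlinarith
  have hΔ2 : 2 ≤ G.maxDegree := hδ.trans G.minDegree_le_maxDegree
  have hne : ∀ v, (G.neighborFinset v).Nonempty := fun v => by
    rw [← Finset.card_pos, G.card_neighborFinset_eq_degree]
    have := G.minDegree_le_degree v
    omega
  let F : V → Finset V := fun v =>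
    Finset.univ.filter fun u => ¬ Disjoint (G.neighborFinset v) (G.neighborFinset u)
  have hF : ∀ v, (F v).card ≤ G.maxDegree ^ 2 := fun v => by
    have hsub : F v ⊆ (G.neighborFinset v).biUnion fun w => G.neighborFinset w := fun u hu => by
      obtain ⟨w, hv, hu⟩ := Finset.not_disjoint_iff.1 (Finset.mem_filter.1 hu).2
      rw [mem_neighborFinset] at hu
      exact Finset.mem_biUnion.2 ⟨w, hv, (G.mem_neighborFinset _ _).2 hu.symm⟩
    refine (Finset.card_le_card hsub).trans
      ((Finset.card_biUnion_le_card_mul _ _ G.maxDegree fun w _ => ?_).trans ?_)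
    · exact G.degree_le_maxDegree w
    · rw [sq]
      exact Nat.mul_le_mul_right _ (G.degree_le_maxDegree v)
  have hself : ∀ v, v ∈ F v := fun v => by
    simpa [F, Finset.disjoint_self_iff_empty, Finset.nonempty_iff_ne_empty] using hne v
  have hsq : 2 ≤ G.maxDegree ^ 2 := by nlinarith
  obtain ⟨T, hT⟩ := exists_forall_notMem_of_exp_mul_le
    (A := fun v => monochromatic (G.neighborFinset v)) (p := 2 / 2 ^ G.minDegree)
    (d := G.maxDegree ^ 2 - 1) (Γ := fun v => (F v).erase v) (by omega)
    (fun v => by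
      rw [Finset.card_erase_of_mem (hself v)]
      exact Nat.sub_le_sub_right (hF v) 1)
    (fun v S hvS hdisj => by
      have hdis : ∀ u ∈ S, Disjoint (G.neighborFinset v) (G.neighborFinset u) := fun u hu => by
        by_contra hcon
        refine Finset.disjoint_left.1 hdisj hu (Finset.mem_erase.2 ⟨?_, by simpa [F] using hcon⟩)
        rintro rfl
        exact hvS hu
      have key := two_pow_mul_card_monochromatic_inter_le (hne v)
        (B := avoiding (fun v => monochromatic (G.neighborFinset v)) S) (fun T T' hTT hmem => by
          refine mem_avoiding.2 fun u hu => ?_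
          have := mem_avoiding.1 hmem u hu
          rwa [mem_monochromatic_congr (T' := T')] at this
          intro a ha
          have hav := Finset.disjoint_right.1 (hdis u hu) ha
          have := Finset.ext_iff.1 hTT a
          simpa [Finset.mem_sdiff, hav] using this)
      rw [G.card_neighborFinset_eq_degree] at key
      have key' := (Nat.mul_le_mul_right _ (Nat.pow_le_pow_right two_pos
        (G.minDegree_le_degree v))).trans key
      rw [div_mul_eq_mul_div, le_div_iff₀ (by positivity), mul_comm]
      exact_mod_cast key')
    (by
      rw [Nat.cast_sub (by omega)]
      push_cast
      rw [sub_add_cancel, mul_div_assoc', div_mul_eq_mul_div, div_le_one (by positivity)]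
      linarith)
  have hdom : ∀ v : V, (∃ u ∈ (T : Set V), G.Adj v u) ∧ (∃ u ∉ (T : Set V), G.Adj v u) := by
    intro v
    have := hT v
    simp only [mem_monochromatic, not_or, Finset.not_subset, Finset.not_disjoint_iff,
      mem_neighborFinset] at this
    obtain ⟨⟨u, hu, huT⟩, w, hw, hwT⟩ := this
    exact ⟨⟨w, by simpa using hwT, hw⟩, u, by simpa using huT, hu⟩
  obtain ⟨u, hu, -⟩ := (hdom hV.some).2
  exact ⟨T, (Set.ssubset_univ_iff).2 fun heq => hu (heq ▸ Set.mem_univ u), hdom⟩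
end

section
/- Let k ≥ 2 and let G be a k-critical finite simple graph (χ(G) = k and every proper induced subgraph has chromatic number strictly less than k) whose maximum degree Δ and minimum degree δ satisfy e·Δ² ≤ 2^{δ−1} (where e is Euler's number). Then χ_d(G) ≤ 2k − 2. -/
open SimpleGraph Set

def IsDynamicColoring {V : Type*} (G : SimpleGraph V) {n : ℕ} (c : V → Fin n) : Prop :=
  (∀ ⦃u v⦄, G.Adj u v → c u ≠ c v) ∧
  ∀ v : V, 2 ≤ (G.neighborSet v).ncard →
    ∃ u w, u ∈ G.neighborSet v ∧ w ∈ G.neighborSet v ∧ c u ≠ c w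

def DynColorable {V : Type*} (G : SimpleGraph V) (n : ℕ) : Prop :=
  ∃ c : V → Fin n, IsDynamicColoring G c

noncomputable def dynChromNum {V : Type*} (G : SimpleGraph V) : ℕ :=
  sInf {n | DynColorable G n}

noncomputable def chromNum {V : Type*} (G : SimpleGraph V) : ℕ :=
  sInf {n | G.Colorable n}

section Splitting

variable {V : Type*} [Fintype V] [DecidableEq V]

/-- The subsets of `V` that split each of the sets `N w`, `w ∈ S`: they neither contain `N w`
nor are disjoint from it. -/
def splitters (N : V → Finset V) (S : Finset V) : Finset (Finset V) :=
  {c | ∀ w ∈ S, ¬ N w ⊆ c ∧ ¬ Disjoint (N w) c}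

/-- The sets splitting each `N w`, `w ∈ S`, but not splitting `N v`. -/
def splittersExcept (N : V → Finset V) (S : Finset V) (v : V) : Finset (Finset V) :=
  {c ∈ splitters N S | N v ⊆ c ∨ Disjoint (N v) c}

theorem mem_splitters {N : V → Finset V} {S c : Finset V} :
    c ∈ splitters N S ↔ ∀ w ∈ S, ¬ N w ⊆ c ∧ ¬ Disjoint (N w) c := by
  simp [splitters]

theorem splitters_anti (N : V → Finset V) {S T : Finset V} (h : T ⊆ S) :
    splitters N S ⊆ splitters N T := fun c hc => by
  rw [mem_splitters] at *
  exact fun w hw => hc w (h hw)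

theorem card_splitters_insert (N : V → Finset V) (S : Finset V) (v : V) :
    (splitters N (insert v S)).card + (splittersExcept N S v).card = (splitters N S).card := by
  rw [← Finset.card_filter_add_card_filter_not (s := splitters N S)
    (fun c => ¬ (N v ⊆ c ∨ Disjoint (N v) c))]
  congr 2
  · ext c
    simp only [mem_splitters, Finset.mem_filter, Finset.forall_mem_insert, not_or]
    tauto
  · ext c
    simp only [splittersExcept, Finset.mem_filter, not_not]

/-- Replacing the trace of a set on `A` does not affect whether it splits sets disjoint
from `A`. -/
theorem sdiff_union_mem_splitters {N : V → Finset V} {T A P c : Finset V}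
    (hT : ∀ w ∈ T, Disjoint (N w) A) (hP : P ⊆ A) (hc : c ∈ splitters N T) :
    (c \ A) ∪ P ∈ splitters N T := by
  rw [mem_splitters] at *
  intro w hw
  have hd := Finset.disjoint_left.1 (hT w hw)
  refine ⟨fun h => (hc w hw).1 fun x hx => ?_, fun h => (hc w hw).2 ?_⟩
  · have := h hx
    have := hd hx
    grind
  · rw [Finset.disjoint_left] at h ⊢
    intro x hx hxc
    have := h hx
    have := hd hx
    grind

theorem card_filter_inter_eq_mul_le {N : V → Finset V} {T A : Finset V}
    (hT : ∀ w ∈ T, Disjoint (N w) A) (B : Finset V) :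
    ((splitters N T).filter (fun c => c ∩ A = B)).card * 2 ^ A.card
      ≤ (splitters N T).card := by
  rw [← Finset.card_powerset, ← Finset.card_product]
  refine Finset.card_le_card_of_injOn (fun p => (p.1 \ A) ∪ p.2) ?_ ?_
  · rintro ⟨c, P⟩ h
    simp only [Finset.coe_product, Set.mem_prod, Finset.mem_coe, Finset.mem_filter,
      Finset.mem_powerset] at h
    exact sdiff_union_mem_splitters hT h.2 h.1.1
  · rintro ⟨c, P⟩ h ⟨c', P'⟩ h' heq
    simp only [Finset.coe_product, Set.mem_prod, Finset.mem_coe, Finset.mem_filter,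
      Finset.mem_powerset] at h h' heq
    obtain ⟨⟨-, h1⟩, h2⟩ := h
    obtain ⟨⟨-, h1'⟩, h2'⟩ := h'
    simp only [Finset.ext_iff, Finset.subset_iff, Finset.mem_union, Finset.mem_sdiff,
      Finset.mem_inter, Prod.mk.injEq] at *
    constructor <;> intro x <;> have := heq x <;> have := h1 x <;> have := h1' x <;>
      have := @h2 x <;> have := @h2' x <;> tauto

theorem card_splittersExcept_mul_le {N : V → Finset V} {T : Finset V} {v : V}
    (hT : ∀ w ∈ T, Disjoint (N w) (N v)) :
    (splittersExcept N T v).card * 2 ^ (N v).card ≤ 2 * (splitters N T).card := by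
  have hsub : splittersExcept N T v ⊆
      (splitters N T).filter (fun c => c ∩ N v = N v) ∪
        (splitters N T).filter (fun c => c ∩ N v = ∅) := fun c hc => by
    simp only [splittersExcept, Finset.mem_filter, Finset.mem_union, Finset.inter_eq_right,
      ← Finset.disjoint_iff_inter_eq_empty, disjoint_comm (a := N v)] at hc ⊢
    tauto
  have h1 := card_filter_inter_eq_mul_le hT (N v)
  have h2 := card_filter_inter_eq_mul_le hT ∅
  have h3 := (Finset.card_le_card hsub).trans (Finset.card_union_le _ _)
  calc _ ≤ _ := Nat.mul_le_mul_right _ h3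
    _ ≤ _ := by rw [add_mul]; omega

/-- The local lemma for splitting a family of sets, in quantitative form. -/
theorem mul_card_splitters_le {N : V → Finset V} {q : ℝ} {d : ℕ} (hq0 : 0 ≤ q) (hq1 : q ≤ 1)
    (hd : ∀ v, ({w | w ≠ v ∧ ¬ Disjoint (N w) (N v)} : Finset V).card ≤ d)
    (hp : ∀ v, 2 ≤ (1 - q) * q ^ d * 2 ^ (N v).card) (S : Finset V) {v : V} (hv : v ∉ S) :
    q * (splitters N S).card ≤ (splitters N (insert v S)).card := by
  induction hn : S.card using Nat.strong_induction_on generalizing S v with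
  | _ n ih =>
    subst hn
    set T := S.filter (fun w => Disjoint (N w) (N v)) with hTdef
    have chain : ∀ R : Finset V, R ⊆ S → Disjoint T R →
        q ^ R.card * (splitters N T).card ≤ (splitters N (T ∪ R)).card := by
      intro R
      induction R using Finset.induction_on with
      | empty => simp
      | insert r R hr ihR =>
        intro hRS hTR
        rw [Finset.disjoint_insert_right] at hTR
        have hRS' := (Finset.subset_insert r R).trans hRS
        have hrTR : r ∉ T ∪ R := by simp [hTR.1, hr]
        have hsub : insert r (T ∪ R) ⊆ S :=
          Finset.insert_subset (hRS (Finset.mem_insert_self _ _))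
            (Finset.union_subset (Finset.filter_subset _ _) hRS')
        have hlt : (T ∪ R).card < S.card := by
          have := Finset.card_le_card hsub
          rw [Finset.card_insert_of_notMem hrTR] at this
          omega
        rw [Finset.card_insert_of_notMem hr, pow_succ', mul_assoc, Finset.union_insert]
        exact (mul_le_mul_of_nonneg_left (ihR hRS' hTR.2) hq0).trans (ih _ hlt _ hrTR rfl)
    set R := S.filter (fun w => ¬ Disjoint (N w) (N v)) with hRdef
    have hR := chain R (Finset.filter_subset _ _) (Finset.disjoint_filter_filter_not _ _ _)
    rw [Finset.filter_union_filter_not_eq] at hR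
    have hRd : R.card ≤ d := (Finset.card_le_card fun w hw => by
      simp only [hRdef, Finset.mem_filter, Finset.mem_univ, true_and] at hw ⊢
      exact ⟨fun h => hv (h ▸ hw.1), hw.2⟩).trans (hd v)
    have hgood : q ^ d * (splitters N T).card ≤ ((splitters N S).card : ℝ) :=
      (mul_le_mul_of_nonneg_right (pow_le_pow_of_le_one hq0 hq1 hRd)
        (Nat.cast_nonneg _)).trans hR
    have hbad : ((splittersExcept N S v).card : ℝ) * 2 ^ (N v).card
        ≤ 2 * (splitters N T).card := by
      have h1 : (splittersExcept N S v).card ≤ (splittersExcept N T v).card :=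
        Finset.card_le_card
          (Finset.filter_subset_filter _ (splitters_anti N (Finset.filter_subset _ _)))
      have h2 := card_splittersExcept_mul_le (N := N) (T := T) (v := v)
        fun w hw => (Finset.mem_filter.1 hw).2
      exact_mod_cast (Nat.mul_le_mul_right _ h1).trans h2
    have hbad' : ((splittersExcept N S v).card : ℝ) ≤ (1 - q) * (splitters N S).card := by
      refine le_of_mul_le_mul_right ?_ (show (0 : ℝ) < 2 ^ (N v).card by positivity)
      calc _ ≤ _ := hbad
        _ ≤ (1 - q) * q ^ d * 2 ^ (N v).card * (splitters N T).card :=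
          mul_le_mul_of_nonneg_right (hp v) (Nat.cast_nonneg _)
        _ = (1 - q) * (q ^ d * (splitters N T).card) * 2 ^ (N v).card := by ring
        _ ≤ _ := by
          have : 0 ≤ 1 - q := by linarith
          gcongr
    have hsum : ((splitters N (insert v S)).card : ℝ) + (splittersExcept N S v).card
        = (splitters N S).card := by
      exact_mod_cast card_splitters_insert N S v
    linarith

theorem splitters_nonempty {N : V → Finset V} {q : ℝ} {d : ℕ} (hq0 : 0 < q) (hq1 : q ≤ 1)
    (hd : ∀ v, ({w | w ≠ v ∧ ¬ Disjoint (N w) (N v)} : Finset V).card ≤ d)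
    (hp : ∀ v, 2 ≤ (1 - q) * q ^ d * 2 ^ (N v).card) (S : Finset V) :
    (splitters N S).Nonempty := by
  induction S using Finset.induction_on with
  | empty => exact ⟨∅, by simp [mem_splitters]⟩
  | insert v S hv ih =>
    have h := mul_card_splitters_le hq0.le hq1 hd hp S hv
    have : (0 : ℝ) < (splitters N S).card := by exact_mod_cast ih.card_pos
    rw [← Finset.card_pos]
    exact_mod_cast (mul_pos hq0 this).trans_le h

end Splitting

theorem one_le_exp_mul_one_sub_inv_pow {D : ℕ} (hD : 2 ≤ D) :
    1 ≤ Real.exp 1 * (1 - (D : ℝ)⁻¹) ^ (D - 1) := by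
  obtain ⟨d, rfl⟩ : ∃ d, D = d + 1 := ⟨D - 1, by omega⟩
  have hd : (0 : ℝ) < d := by exact_mod_cast (by omega : 0 < d)
  have h1 : (1 + (d : ℝ)⁻¹) ^ d ≤ Real.exp 1 := by
    calc (1 + (d : ℝ)⁻¹) ^ d ≤ Real.exp ((d : ℝ)⁻¹) ^ d := by
          gcongr
          linarith [Real.add_one_le_exp ((d : ℝ)⁻¹)]
      _ = Real.exp 1 := by
          rw [← Real.exp_nat_mul, mul_inv_cancel₀ hd.ne']
  have h2 : (1 + (d : ℝ)⁻¹) * (1 - ((d + 1 : ℕ) : ℝ)⁻¹) = 1 := by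
    push_cast
    field_simp
    ring
  have h3 : (0 : ℝ) ≤ 1 - ((d + 1 : ℕ) : ℝ)⁻¹ :=
    sub_nonneg.2 (inv_le_one_of_one_le₀ (by push_cast; linarith))
  rw [Nat.add_sub_cancel]
  calc (1 : ℝ) = (1 + (d : ℝ)⁻¹) ^ d * (1 - ((d + 1 : ℕ) : ℝ)⁻¹) ^ d := by
        rw [← mul_pow, h2, one_pow]
    _ ≤ _ := by gcongr

/-- If `e·Δ² ≤ 2^(δ-1)` and `0 < Δ`, the vertices can be split into two parts such that every
vertex has neighbors in both. -/
theorem exists_set_splitting_neighborSets {V : Type*} [Fintype V] (G : SimpleGraph V)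
    [DecidableRel G.Adj] (hΔ : 0 < G.maxDegree)
    (h : Real.exp 1 * (G.maxDegree : ℝ) ^ 2 ≤ (2 : ℝ) ^ ((G.minDegree : ℝ) - 1)) :
    ∃ A : Set V, ∀ v, (∃ u ∈ A, G.Adj v u) ∧ ∃ u ∉ A, G.Adj v u := by
  classical
  have he : (2 : ℝ) < Real.exp 1 := by linarith [Real.exp_one_gt_d9]
  have h' : Real.exp 1 * (G.maxDegree : ℝ) ^ 2 * 2 ≤ 2 ^ G.minDegree := by
    rw [Real.rpow_sub_one two_ne_zero, Real.rpow_natCast] at h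
    linarith
  have hΔ1 : (1 : ℝ) ≤ (G.maxDegree : ℝ) ^ 2 := one_le_pow₀ (by exact_mod_cast hΔ)
  have hδ : 2 ≤ G.minDegree := by
    by_contra! hlt
    have : (2 : ℝ) ^ G.minDegree ≤ 2 ^ 1 := pow_le_pow_right₀ one_le_two (by omega)
    nlinarith
  have hne : Nonempty V := by
    by_contra hV
    rw [not_nonempty_iff] at hV
    simp [SimpleGraph.maxDegree] at hΔ
  have hΔ2 : 2 ≤ G.maxDegree := hδ.trans G.minDegree_le_maxDegree
  set D := G.maxDegree ^ 2 with hDdef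
  have hD : 2 ≤ D := by nlinarith
  have hDpos : (0 : ℝ) < D := by positivity
  have hDR : (D : ℝ) = (G.maxDegree : ℝ) ^ 2 := by simp [D]
  have hinv : (D : ℝ)⁻¹ < 1 := inv_lt_one_of_one_lt₀ (by exact_mod_cast hD)
  have hd : ∀ v, ({w | w ≠ v ∧ ¬ Disjoint (G.neighborFinset w) (G.neighborFinset v)} :
      Finset V).card ≤ D - 1 := by
    intro v
    have hsub : insert v ({w | w ≠ v ∧
        ¬ Disjoint (G.neighborFinset w) (G.neighborFinset v)} : Finset V) ⊆
        (G.neighborFinset v).biUnion fun u => G.neighborFinset u := by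
      intro w hw
      simp only [Finset.mem_insert, Finset.mem_filter, Finset.mem_univ, true_and,
        Finset.not_disjoint_iff, mem_neighborFinset] at hw
      simp only [Finset.mem_biUnion, mem_neighborFinset]
      rcases hw with rfl | ⟨-, u, hu, hu'⟩
      · obtain ⟨u, hu⟩ := (G.degree_pos_iff_exists_adj w).1
          (by have := G.minDegree_le_degree w; omega)
        exact ⟨u, hu, hu.symm⟩
      · exact ⟨u, hu', hu.symm⟩
    have hcard := (Finset.card_le_card hsub).trans
      (Finset.card_biUnion_le_card_mul _ _ G.maxDegree fun u _ => G.degree_le_maxDegree u)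
    rw [Finset.card_insert_of_notMem (by simp), card_neighborFinset_eq_degree] at hcard
    have := Nat.mul_le_mul_right G.maxDegree (G.degree_le_maxDegree v)
    rw [← pow_two] at this
    omega
  have hp : ∀ v, 2 ≤ (1 - (1 - (D : ℝ)⁻¹)) * (1 - (D : ℝ)⁻¹) ^ (D - 1) *
      2 ^ (G.neighborFinset v).card := by
    intro v
    rw [card_neighborFinset_eq_degree]
    have hpow : (2 : ℝ) ^ G.minDegree ≤ 2 ^ G.degree v :=
      pow_le_pow_right₀ one_le_two (G.minDegree_le_degree v)
    have hexp := one_le_exp_mul_one_sub_inv_pow hD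
    set y : ℝ := (1 - (D : ℝ)⁻¹) ^ (D - 1)
    have hy : 0 ≤ y := pow_nonneg (by linarith) _
    rw [← hDR] at h'
    rw [sub_sub_cancel]
    calc (2 : ℝ) ≤ (Real.exp 1 * y) * 2 := by linarith
      _ = (D : ℝ)⁻¹ * y * (Real.exp 1 * D * 2) := by field_simp
      _ ≤ _ := by
        gcongr
        exact h'.trans hpow
  obtain ⟨c, hc⟩ := splitters_nonempty (N := fun v => G.neighborFinset v)
    (by linarith) (by linarith [inv_pos.2 hDpos]) hd hp Finset.univ
  rw [mem_splitters] at hc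
  refine ⟨c, fun v => ?_⟩
  obtain ⟨h1, h2⟩ := hc v (Finset.mem_univ v)
  rw [Finset.not_subset] at h1
  rw [Finset.not_disjoint_iff] at h2
  simp only [mem_neighborFinset] at h1 h2
  obtain ⟨a, ha, ha'⟩ := h1
  obtain ⟨b, hb, hb'⟩ := h2
  exact ⟨⟨b, hb', hb⟩, a, ha', ha⟩

theorem colorable_chromNum {V : Type*} [Finite V] (G : SimpleGraph V) :
    G.Colorable (chromNum G) := by
  have := Fintype.ofFinite V
  exact Nat.sInf_mem (s := {n | G.Colorable n}) ⟨_, G.colorable_of_fintype⟩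

/-- Colorings of the two parts of a splitting, with disjoint palettes, combine to a dynamic
coloring. -/
theorem dynColorable_of_induce_colorable {V : Type*} {G : SimpleGraph V} {A : Set V} {m n : ℕ}
    (hA : ∀ v, (∃ u ∈ A, G.Adj v u) ∧ ∃ u ∉ A, G.Adj v u)
    (h1 : (G.induce A).Colorable m) (h2 : (G.induce Aᶜ).Colorable n) :
    DynColorable G (m + n) := by
  classical
  obtain ⟨f⟩ := h1
  obtain ⟨g⟩ := h2
  let c : V → Fin (m + n) := fun v =>
    if hv : v ∈ A then Fin.castAdd n (f ⟨v, hv⟩) else Fin.natAdd m (g ⟨v, hv⟩)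
  have hcA : ∀ v (hv : v ∈ A), c v = Fin.castAdd n (f ⟨v, hv⟩) := fun v hv => by simp [c, hv]
  have hcB : ∀ v (hv : v ∉ A), c v = Fin.natAdd m (g ⟨v, hv⟩) := fun v hv => by simp [c, hv]
  have hAB : ∀ u ∈ A, ∀ w ∉ A, c u ≠ c w := fun u hu w hw heq => by
    rw [hcA u hu, hcB w hw, Fin.ext_iff, Fin.val_castAdd, Fin.val_natAdd] at heq
    omega
  refine ⟨c, fun u v huv => ?_, fun v _ => ?_⟩
  · by_cases hu : u ∈ A <;> by_cases hv : v ∈ A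
    · rw [hcA u hu, hcA v hv, Ne, Fin.castAdd_inj]
      exact f.valid (by simpa using huv)
    · exact hAB u hu v hv
    · exact (hAB v hv u hu).symm
    · rw [hcB u hu, hcB v hv, Ne, Fin.natAdd_inj]
      exact g.valid (by simpa using huv)
  · obtain ⟨⟨u, hu, huv⟩, w, hw, hwv⟩ := hA v
    exact ⟨u, w, huv, hwv, hAB u hu w hw⟩

/-- If `G` is a `k`-critical finite graph (`k ≥ 2`) with `e·Δ² ≤ 2^(δ-1)`, then
`χ_d(G) ≤ 2k - 2`. -/
theorem dynChromNum_le_of_critical {V : Type*} [Fintype V] (G : SimpleGraph V)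
    [DecidableRel G.Adj] (k : ℕ) (hk : 2 ≤ k)
    (hchrom : chromNum G = k)
    (hcrit : ∀ S : Set V, S ⊂ Set.univ → chromNum (G.induce S) < k)
    (h : Real.exp 1 * (G.maxDegree : ℝ) ^ 2 ≤ (2 : ℝ) ^ ((G.minDegree : ℝ) - 1)) :
    dynChromNum G ≤ 2 * k - 2 := by
  have hΔ : 0 < G.maxDegree := by
    by_contra! h0
    have hG : G.Colorable 1 := ⟨Coloring.mk (fun _ => 0) fun {u v} huv => by
      have := (G.degree_pos_iff_exists_adj u).2 ⟨v, huv⟩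
      have := G.degree_le_maxDegree u
      omega⟩
    have : chromNum G ≤ 1 := Nat.sInf_le hG
    omega
  obtain ⟨A, hA⟩ := exists_set_splitting_neighborSets G hΔ h
  have hne : Nonempty V := by
    by_contra hV
    rw [not_nonempty_iff] at hV
    simp [SimpleGraph.maxDegree] at hΔ
  obtain ⟨v⟩ := hne
  obtain ⟨⟨u, hu, -⟩, w, hw, -⟩ := hA v
  have key : ∀ S : Set V, S ≠ Set.univ → (G.induce S).Colorable (k - 1) := fun S hS =>
    (colorable_chromNum (G.induce S)).mono
      (Nat.le_sub_one_of_lt (hcrit S (Set.ssubset_univ_iff.2 hS)))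
  have hdyn := dynColorable_of_induce_colorable hA
    (key A fun hS => hw (hS ▸ Set.mem_univ w))
    (key Aᶜ fun hS => (hS ▸ Set.mem_univ u : u ∈ Aᶜ) hu)
  have hle : dynChromNum G ≤ k - 1 + (k - 1) := Nat.sInf_le hdyn
  omega
end
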